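/- Let Φ be a free group and P = ⟨x, Φ; R⟩ an M_Φ-presentation. Then the group G = G(P) is residually finite. -/

import Mathlib

open Monoid

section Defs
variable {X Y H : Type*}

/-- `φ_W^θ(j)`: the sum `Σ_{i=1}^{j} ε_i θ(x_i)` of the weights of the first `j`
letters of the word `W` (a word is a nonempty list of pairs (letter, exponent sign)). -/
def phiW (θ : X → ℤ) (W : List (X × Bool)) (j : ℕ) : ℤ :=
  ((W.take j).map fun p => if p.2 then θ p.1 else -θ p.1).sum

/-- A weight function: a map `θ : X → ℤ` whose image generates the additive group `ℤ`. -/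
def IsWeightFun (θ : X → ℤ) : Prop :=
  AddSubgroup.closure (Set.range θ) = ⊤

/-- A strict weight function: `θ x ≠ 0` for all `x`. -/
def IsStrictWeight (θ : X → ℤ) : Prop := ∀ x, θ x ≠ 0

/-- `θ` is admissible for `W` if `φ(r) = 0` where `r` is the length of `W`. -/
def IsAdmissible (θ : X → ℤ) (W : List (X × Bool)) : Prop :=
  phiW θ W W.length = 0

/-- The successor of an index, cyclically (subscripts mod `r`). -/
def succIdx (W : List (X × Bool)) (k : Fin W.length) : Fin W.length :=
  ⟨(k.1 + 1) % W.length, Nat.mod_lt _ k.pos⟩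

/-- `W` has the unique max-min property with respect to the weight function `θ`:
`θ` is a strict weight function, admissible for `W`, the graph of `W` has a unique
maximum at `k` and a unique minimum at `l`, and `W` is reduced at the maximum and
minimum (`x_k ≠ x_{k+1}`, `x_l ≠ x_{l+1}`, subscripts mod `r`). -/
def UniqueMaxMinWith (θ : X → ℤ) (W : List (X × Bool)) : Prop :=
  W ≠ [] ∧ IsWeightFun θ ∧ IsStrictWeight θ ∧ IsAdmissible θ W ∧
  ∃ k l : Fin W.length,
    (∀ j : Fin W.length, j ≠ k → phiW θ W (j.1 + 1) < phiW θ W (k.1 + 1)) ∧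
    (∀ j : Fin W.length, j ≠ l → phiW θ W (l.1 + 1) < phiW θ W (j.1 + 1)) ∧
    (W.get k).1 ≠ (W.get (succIdx W k)).1 ∧
    (W.get l).1 ≠ (W.get (succIdx W l)).1

/-- `W` has the unique max-min property: it has it with respect to some
admissible strict weight function. -/
def HasUniqueMaxMin (W : List (X × Bool)) : Prop :=
  ∃ θ : X → ℤ, UniqueMaxMinWith θ W

/-- The `x`-skeleton of a relator `R = x₁^{ε₁} h₁ ⋯ x_r^{ε_r} h_r`
(encoded as the list of triples `(xᵢ, εᵢ, hᵢ)`): the word `x₁^{ε₁} ⋯ x_r^{ε_r}`. -/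
def skel (R : List (X × Bool × H)) : List (X × Bool) :=
  R.map fun t => (t.1, t.2.1)

variable [Group H]

/-- The element of the free product `H ∗ F(X)` represented by the relator
`R = x₁^{ε₁} h₁ ⋯ x_r^{ε_r} h_r`. -/
def relWord (R : List (X × Bool × H)) : Coprod H (FreeGroup X) :=
  (R.map fun t => Coprod.inr (FreeGroup.mk [(t.1, t.2.1)]) * Coprod.inl t.2.2).prod

/-- The group `G(P)` defined by the relative one-relator presentation
`P = ⟨x, H; R⟩`: the quotient of `H ∗ F(X)` by the normal closure of `R`. -/
def relGroup (R : List (X × Bool × H)) : Type _ :=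
  Coprod H (FreeGroup X) ⧸ Subgroup.normalClosure {relWord R}

instance (R : List (X × Bool × H)) : Group (relGroup R) :=
  QuotientGroup.Quotient.group _

/-- The natural homomorphism `ν : H → G(P)`. -/
def natHom (R : List (X × Bool × H)) : H →* relGroup R :=
  (QuotientGroup.mk' _).comp Coprod.inl

end Defs

/-- A group is residually finite if every nontrivial element is sent to a
nontrivial element by some homomorphism to a finite group. -/
def ResiduallyFinite (G : Type*) [Group G] : Prop :=
  ∀ g : G, g ≠ 1 → ∃ (Q : Type) (_ : Group Q) (_ : Finite Q) (f : G →* Q), f g ≠ 1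

/-- A partial injection of a finite type extends to a permutation. -/
theorem exists_perm_extending {α : Type*} [Finite α] (r : α → α → Prop)
    (h₁ : ∀ i j j', r i j → r i j' → j = j') (h₂ : ∀ i i' j, r i j → r i' j → i = i') :
    ∃ σ : Equiv.Perm α, ∀ i j, r i j → σ i = j := by
  classical
  have := Fintype.ofFinite α
  let e : {i // ∃ j, r i j} ≃ {j // ∃ i, r i j} :=
    { toFun := fun i => ⟨i.2.choose, i.1, i.2.choose_spec⟩
      invFun := fun j => ⟨j.2.choose, j.1, j.2.choose_spec⟩
      left_inv := fun i => Subtype.ext <| by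
        have h : ∃ i', r i' i.2.choose := ⟨i.1, i.2.choose_spec⟩
        exact h₂ _ _ _ h.choose_spec i.2.choose_spec
      right_inv := fun j => Subtype.ext <| by
        have h : ∃ j', r j.2.choose j' := ⟨j.1, j.2.choose_spec⟩
        exact h₁ _ _ _ h.choose_spec j.2.choose_spec }
  refine ⟨e.extendSubtype, fun i j hij => ?_⟩
  have hi : ∃ j, r i j := ⟨j, hij⟩
  rw [e.extendSubtype_apply_of_mem i hi]
  exact h₁ _ _ _ hi.choose_spec hij

/-- Free groups are residually finite. -/
theorem FreeGroup.exists_finite_quotient {α : Type*} (g : FreeGroup α) (hg : g ≠ 1) :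
    ∃ (n : ℕ) (f : FreeGroup α →* Equiv.Perm (Fin n)), f g ≠ 1 := by
  classical
  set L := g.toWord with hL
  have hred : FreeGroup.IsReduced L := FreeGroup.isReduced_toWord
  let r : α → Fin (L.length + 1) → Fin (L.length + 1) → Prop := fun x i j =>
    (i.1 = j.1 + 1 ∧ L[j.1]? = some (x, true)) ∨ (j.1 = i.1 + 1 ∧ L[i.1]? = some (x, false))
  have hcons : ∀ (k : ℕ) (x : α) (b c : Bool), L[k]? = some (x, b) → L[k + 1]? = some (x, c) →
      b = c := by
    intro k x b c hb hc
    obtain ⟨h1, h1'⟩ := List.getElem?_eq_some_iff.1 hb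
    obtain ⟨h2, h2'⟩ := List.getElem?_eq_some_iff.1 hc
    have := List.isChain_iff_getElem.1 hred k h2
    simpa [h1', h2'] using this
  have hσ : ∀ x, ∃ σ : Equiv.Perm (Fin (L.length + 1)), ∀ i j, r x i j → σ i = j := by
    intro x
    refine exists_perm_extending _ ?_ ?_
    · rintro i j j' (⟨h1, h2⟩ | ⟨h1, h2⟩) (⟨h3, h4⟩ | ⟨h3, h4⟩) <;> apply Fin.ext
      · omega
      · rw [h1] at h4
        simpa using hcons _ _ _ _ h2 h4
      · rw [h3] at h2
        simpa using hcons _ _ _ _ h4 h2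
      · omega
    · rintro i j j' (⟨h1, h2⟩ | ⟨h1, h2⟩) (⟨h3, h4⟩ | ⟨h3, h4⟩) <;> apply Fin.ext
      · omega
      · rw [h3] at h2
        simpa using hcons _ _ _ _ h4 h2
      · rw [h1] at h4
        simpa using hcons _ _ _ _ h2 h4
      · omega
  choose σ hσ using hσ
  refine ⟨L.length + 1, FreeGroup.lift σ, fun h => ?_⟩
  have key : ∀ L₂ L₁ : List (α × Bool), L = L₁ ++ L₂ →
      (FreeGroup.lift σ (FreeGroup.mk L₂) (Fin.last L.length)).1 = L₁.length := by
    intro L₂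
    induction L₂ with
    | nil => intro L₁ h; simp [h]
    | cons p L₂ ih =>
      intro L₁ h
      have h3 := ih (L₁ ++ [p]) (by simp [h])
      have hlen : L₁.length < L.length := by simp [h]
      have h4 : FreeGroup.lift σ (FreeGroup.mk L₂) (Fin.last L.length) =
          ⟨L₁.length + 1, by omega⟩ := Fin.ext (by simpa using h3)
      have h5 : L[L₁.length]? = some p := by simp [h]
      rw [show FreeGroup.mk (p :: L₂) = FreeGroup.mk [p] * FreeGroup.mk L₂ from rfl, _root_.map_mul,
        Equiv.Perm.mul_apply, h4]
      obtain ⟨x, b⟩ := p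
      cases b
      · have := hσ x ⟨L₁.length, by omega⟩ ⟨L₁.length + 1, by omega⟩ (Or.inr ⟨rfl, h5⟩)
        simp [FreeGroup.lift_mk, ← this]
      · have := hσ x ⟨L₁.length + 1, by omega⟩ ⟨L₁.length, by omega⟩ (Or.inl ⟨rfl, h5⟩)
        simp [FreeGroup.lift_mk, this]
  have h0 := key L [] rfl
  rw [show FreeGroup.mk L = g from FreeGroup.mk_toWord, h] at h0
  change L.length = 0 at h0
  exact hg (FreeGroup.toWord_eq_nil_iff.1 (List.length_eq_zero_iff.1 h0))

/-- The letter `e` occurs exactly once in the word `L`, with either sign. -/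
def OccursOnce {α : Type*} (e : α) (L : List (α × Bool)) : Prop :=
  ∃ L₁ b L₂, L = L₁ ++ (e, b) :: L₂ ∧ (∀ p ∈ L₁, p.1 ≠ e) ∧ ∀ p ∈ L₂, p.1 ≠ e

theorem OccursOnce.exists_mem {α : Type*} {e : α} {L : List (α × Bool)} (h : OccursOnce e L) :
    ∃ p ∈ L, p.1 = e := by
  obtain ⟨L₁, b, L₂, rfl, -, -⟩ := h
  exact ⟨(e, b), by simp, rfl⟩

theorem OccursOnce.map {α β : Type*} {f : α → β} (hf : f.Injective) {e : α}
    {L : List (α × Bool)} (h : OccursOnce e L) :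
    OccursOnce (f e) (L.map fun p => (f p.1, p.2)) := by
  obtain ⟨L₁, b, L₂, rfl, h1, h2⟩ := h
  refine ⟨_, b, _, by rw [List.map_append, List.map_cons], ?_, ?_⟩
  · rintro _ hp
    obtain ⟨p, hp', rfl⟩ := List.mem_map.1 hp
    exact hf.ne (h1 p hp')
  · rintro _ hp
    obtain ⟨p, hp', rfl⟩ := List.mem_map.1 hp
    exact hf.ne (h2 p hp')

theorem FreeGroup.lift_mk_congr {α Γ : Type*} [Group Γ] {ξ ξ' : α → Γ} {L : List (α × Bool)}
    (h : ∀ p ∈ L, ξ p.1 = ξ' p.1) :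
    FreeGroup.lift ξ (FreeGroup.mk L) = FreeGroup.lift ξ' (FreeGroup.mk L) := by
  rw [FreeGroup.lift_mk, FreeGroup.lift_mk]
  exact congrArg _ (List.map_congr_left fun p hp => by rw [h p hp])

/-- An equation can be solved for a letter that occurs exactly once in it, and the solution is
determined by the other letters. -/
theorem OccursOnce.exists_solution {α Γ : Type*} [Group Γ] {e : α} {L : List (α × Bool)}
    (h : OccursOnce e L) (ξ : α → Γ) :
    ∃ q : Γ, ∀ ξ' : α → Γ, (∀ p ∈ L, p.1 ≠ e → ξ' p.1 = ξ p.1) →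
      (FreeGroup.lift ξ' (FreeGroup.mk L) = 1 ↔ ξ' e = q) := by
  obtain ⟨L₁, b, L₂, rfl, h1, h2⟩ := h
  set u := FreeGroup.lift ξ (FreeGroup.mk L₁)
  set v := FreeGroup.lift ξ (FreeGroup.mk L₂)
  refine ⟨cond b (u⁻¹ * v⁻¹) (v * u), fun ξ' hξ => ?_⟩
  have e1 : FreeGroup.lift ξ' (FreeGroup.mk L₁) = u :=
    FreeGroup.lift_mk_congr fun p hp => hξ p (by simp [hp]) (h1 p hp)
  have e2 : FreeGroup.lift ξ' (FreeGroup.mk L₂) = v :=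
    FreeGroup.lift_mk_congr fun p hp => hξ p (by simp [hp]) (h2 p hp)
  rw [show FreeGroup.mk (L₁ ++ (e, b) :: L₂) =
    FreeGroup.mk L₁ * (FreeGroup.mk [(e, b)] * FreeGroup.mk L₂) from rfl, map_mul, map_mul, e1, e2]
  cases b
  · simp only [FreeGroup.lift_mk, List.map_cons, cond_false, List.map_nil, List.prod_cons,
      List.prod_nil, mul_one]
    constructor
    · intro h
      rw [← mul_assoc, mul_eq_one_iff_eq_inv, mul_inv_eq_iff_eq_mul] at h
      simp [h]
    · intro h; simp [h]
  · simp only [FreeGroup.lift_mk, List.map_cons, cond_true, List.map_nil, List.prod_cons,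
      List.prod_nil, mul_one]
    constructor
    · intro h
      rw [← mul_assoc, mul_eq_one_iff_eq_inv] at h
      rw [← h]; group
    · intro h; simp [h]

/-- Translate the second coordinates of the letters of a word by `j`. -/
def shiftWord {Z : Type*} (j : ℤ) (E : List ((Z × ℤ) × Bool)) : List ((Z × ℤ) × Bool) :=
  E.map fun p => ((p.1.1, p.1.2 + j), p.2)

theorem mem_shiftWord {Z : Type*} {j : ℤ} {E : List ((Z × ℤ) × Bool)} {p : (Z × ℤ) × Bool} :
    p ∈ shiftWord j E ↔ ((p.1.1, p.1.2 - j), p.2) ∈ E := by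
  obtain ⟨⟨z, i⟩, b⟩ := p
  simp only [shiftWord, List.mem_map]
  constructor
  · rintro ⟨⟨⟨z', i'⟩, b'⟩, h, h'⟩
    simp only [Prod.mk.injEq] at h'
    obtain ⟨⟨rfl, rfl⟩, rfl⟩ := h'
    simpa using h
  · intro h
    exact ⟨_, h, by simp⟩

theorem shiftWord_shiftWord {Z : Type*} (j k : ℤ) (E : List ((Z × ℤ) × Bool)) :
    shiftWord j (shiftWord k E) = shiftWord (k + j) E := by
  simp [shiftWord, add_assoc]

theorem OccursOnce.shiftWord {Z : Type*} {a : Z} {c : ℤ} {E : List ((Z × ℤ) × Bool)}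
    (h : OccursOnce (a, c) E) (j : ℤ) : OccursOnce (a, c + j) (shiftWord j E) :=
  OccursOnce.map (f := fun x : Z × ℤ => (x.1, x.2 + j))
    (fun x y h => by simpa [Prod.ext_iff] using h) h

theorem lift_mk_shiftWord {Z Γ : Type*} [Group Γ] (ξ : Z × ℤ → Γ) (j : ℤ)
    (E : List ((Z × ℤ) × Bool)) :
    FreeGroup.lift ξ (FreeGroup.mk (shiftWord j E)) =
      FreeGroup.lift (fun x => ξ (x.1, x.2 + j)) (FreeGroup.mk E) := by
  simp [shiftWord, FreeGroup.lift_mk, Function.comp_def]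

/-- Finitely many consecutive translates of a relator whose top letter occurs once can be
killed by an endomorphism of the free group through which `π` factors. -/
theorem exists_elimination {Z G : Type*} [Group G] {E : List ((Z × ℤ) × Bool)} {a : Z} {c : ℤ}
    (hc : OccursOnce (a, c) E) (hac : ∀ p ∈ E, p.1.1 = a → p.1.2 ≤ c)
    (π : FreeGroup (Z × ℤ) →* G) (hπ : ∀ j, π (FreeGroup.mk (shiftWord j E)) = 1)
    (lo : ℤ) (k : ℕ) :
    ∃ σ : FreeGroup (Z × ℤ) →* FreeGroup (Z × ℤ), π.comp σ = π ∧
      ∀ j, lo ≤ j → j < lo + k → σ (FreeGroup.mk (shiftWord j E)) = 1 := by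
  classical
  induction k with
  | zero => exact ⟨MonoidHom.id _, rfl, fun j h1 h2 => by simp at h2; omega⟩
  | succ k ih =>
    obtain ⟨σ, h1, h2⟩ := ih
    set j₀ : ℤ := lo + k with hj₀
    have ho := hc.shiftWord j₀
    obtain ⟨q, hq⟩ := ho.exists_solution (FreeGroup.of : Z × ℤ → FreeGroup (Z × ℤ))
    set τ := FreeGroup.lift (Function.update (FreeGroup.of : Z × ℤ → _) (a, c + j₀) q) with hτ
    have hτ1 : τ (FreeGroup.mk (shiftWord j₀ E)) = 1 :=
      (hq _ fun p _ hp => Function.update_of_ne hp _ _).2 (Function.update_self _ _ _)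
    have hπτ : π.comp τ = π := by
      obtain ⟨q', hq'⟩ := ho.exists_solution (π ∘ FreeGroup.of)
      have e1 : FreeGroup.lift (π ∘ FreeGroup.of) = π := by ext x; simp
      have e2 : FreeGroup.lift (π ∘ (Function.update (FreeGroup.of : Z × ℤ → _) (a, c + j₀) q)) =
          π.comp τ := by ext x; simp [hτ]
      have h3 := (hq' (π ∘ FreeGroup.of) fun _ _ _ => rfl).1 (by rw [e1, hπ])
      have h4 := (hq' (π ∘ (Function.update (FreeGroup.of : Z × ℤ → _) (a, c + j₀) q))
        fun p _ hp => by simp [Function.update_of_ne hp]).1 (by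
          rw [e2, MonoidHom.comp_apply, hτ1, map_one])
      ext x
      by_cases hx : x = (a, c + j₀)
      · subst hx
        simpa [hτ] using h4.trans h3.symm
      · simp [hτ, Function.update_of_ne hx]
    refine ⟨σ.comp τ, by rw [← MonoidHom.comp_assoc, h1, hπτ], fun j hj1 hj2 => ?_⟩
    rw [MonoidHom.comp_apply]
    by_cases hj : j = j₀
    · rw [hj, hτ1, map_one]
    · have hlt : j < lo + k := by push_cast at hj2; omega
      have e3 : τ (FreeGroup.mk (shiftWord j E)) = FreeGroup.mk (shiftWord j E) := by
        refine (FreeGroup.lift_mk_congr (ξ' := FreeGroup.of) fun p hp =>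
          Function.update_of_ne ?_ _ _).trans (FreeGroup.lift_of_apply _)
        intro h
        have := hac _ (mem_shiftWord.1 hp) (by simp [h])
        simp [h] at this
        omega
      rw [e3, h2 j hj1 hlt]

/-- A sequence in a finite set satisfying a reversible recursion with periodic coefficients is
periodic. -/
theorem exists_period_of_reversible {Q : Type*} [Finite Q] (s : ℕ → Q) (ℓ L : ℕ) (hL : 0 < L)
    (hup : ∀ p j, L ∣ p → (∀ i < ℓ, s (j + i) = s (j + i + p)) → s (j + ℓ) = s (j + ℓ + p))
    (hdown : ∀ p j, L ∣ p → (∀ i < ℓ, s (j + 1 + i) = s (j + 1 + i + p)) → s j = s (j + p)) :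
    ∃ P, 0 < P ∧ L ∣ P ∧ ∀ i, s (i + P) = s i := by
  obtain ⟨k, k', hne, hk⟩ := Finite.exists_ne_map_eq_of_infinite
    (fun (k : ℕ) (i : Fin ℓ) => s (k * L + i))
  wlog hlt : k < k' generalizing k k'
  · exact this k' k hne.symm hk.symm (by omega)
  obtain ⟨d, rfl⟩ := Nat.exists_eq_add_of_lt hlt
  have hdvd : L ∣ (d + 1) * L := Dvd.intro_left _ rfl
  have hwin : ∀ n ≤ k * L, ∀ i < ℓ, s (k * L - n + i) = s (k * L - n + i + (d + 1) * L) := by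
    intro n
    induction n with
    | zero =>
      intro _ i hi
      have := congrFun hk ⟨i, hi⟩
      simp only at this
      rw [Nat.sub_zero, this]
      congr 1
      ring
    | succ n ih =>
      intro hn i hi
      have h1 := ih (by omega)
      obtain ⟨t, ht⟩ : ∃ t, k * L - n = t + 1 := ⟨k * L - n - 1, by omega⟩
      have ht' : k * L - (n + 1) = t := by omega
      rw [ht] at h1
      rw [ht']
      rcases i with _ | i
      · exact hdown _ _ hdvd h1
      · have := h1 i (by omega)
        rwa [show t + (i + 1) = t + 1 + i by ring]
  have hall : ∀ i, s i = s (i + (d + 1) * L) := by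
    intro i
    induction i using Nat.strong_induction_on with
    | _ i ih =>
      by_cases hi : i < ℓ
      · have := hwin (k * L) le_rfl i hi
        simpa using this
      · obtain ⟨t, rfl⟩ := Nat.exists_eq_add_of_le' (not_lt.1 hi)
        exact hup _ _ hdvd fun i' hi' => ih _ (by omega)
  exact ⟨(d + 1) * L, by positivity, hdvd, fun i => (hall i).symm⟩

/-- The sum of the weights of the letters of a word. -/
def wordWeight {Z : Type*} (θ : Z → ℤ) (l : List (Z × Bool)) : ℤ :=
  (l.map fun p => if p.2 then θ p.1 else -θ p.1).sum

/-- The edges traversed by the path of a word starting at height `q`: reading the letter `z`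
(resp. `z⁻¹`) moves the height by `θ z` (resp. `-θ z`), and the edge is labelled by `z` and
the end (resp. the start) of the step. -/
def pathEdges {Z : Type*} (θ : Z → ℤ) : List (Z × Bool) → ℤ → List ((Z × ℤ) × Bool)
  | [], _ => []
  | (z, true) :: l, q => ((z, q + θ z), true) :: pathEdges θ l (q + θ z)
  | (z, false) :: l, q => ((z, q), false) :: pathEdges θ l (q - θ z)

theorem pathEdges_add {Z : Type*} (θ : Z → ℤ) (l : List (Z × Bool)) (q j : ℤ) :
    pathEdges θ l (q + j) = shiftWord j (pathEdges θ l q) := by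
  induction l generalizing q with
  | nil => rfl
  | cons p l ih =>
    obtain ⟨z, _ | _⟩ := p
    · simp only [pathEdges, shiftWord, List.map_cons]
      rw [show q + j - θ z = q - θ z + j by ring, ih]; rfl
    · simp only [pathEdges, shiftWord, List.map_cons]
      rw [show q + j + θ z = q + θ z + j by ring, ih]; rfl

theorem pathEdges_eq_shiftWord {Z : Type*} (θ : Z → ℤ) (l : List (Z × Bool)) (j : ℤ) :
    pathEdges θ l j = shiftWord j (pathEdges θ l 0) := by
  rw [← pathEdges_add, zero_add]

theorem lift_mk_pathEdges_fst {Z Γ : Type*} [Group Γ] (θ : Z → ℤ) (g : Z → Γ)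
    (l : List (Z × Bool)) (q : ℤ) :
    FreeGroup.lift (fun x : Z × ℤ => g x.1) (FreeGroup.mk (pathEdges θ l q)) =
      FreeGroup.lift g (FreeGroup.mk l) := by
  simp only [FreeGroup.lift_mk]
  induction l generalizing q with
  | nil => rfl
  | cons p l ih => obtain ⟨z, _ | _⟩ := p <;> simp [pathEdges, ih]

/-- A labelling of the edges over `ZMod P` by elements of a group `Q` gives an action of the
letters on `ZMod P × Q`. -/
def labelPerm {Z Q : Type*} [Group Q] {P : ℕ} (θ : Z → ℤ) (η : Z → ZMod P → Q) (z : Z) :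
    Equiv.Perm (ZMod P × Q) where
  toFun x := (x.1 - θ z, η z x.1 * x.2)
  invFun x := (x.1 + θ z, (η z (x.1 + θ z))⁻¹ * x.2)
  left_inv x := by simp
  right_inv x := by simp

theorem lift_labelPerm_apply {Z Q : Type*} [Group Q] {P : ℕ} (θ : Z → ℤ) (η : Z → ZMod P → Q)
    (l : List (Z × Bool)) (q : ℤ) (γ : Q) :
    FreeGroup.lift (labelPerm θ η) (FreeGroup.mk l) (((q + wordWeight θ l : ℤ) : ZMod P), γ) =
      ((q : ZMod P), FreeGroup.lift (fun x : Z × ℤ => η x.1 (x.2 : ZMod P))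
        (FreeGroup.mk (pathEdges θ l q)) * γ) := by
  simp only [FreeGroup.lift_mk]
  induction l generalizing q with
  | nil => simp [wordWeight, pathEdges]
  | cons p l ih =>
    obtain ⟨z, _ | _⟩ := p
    · have := ih (q - θ z)
      rw [show q + wordWeight θ ((z, false) :: l) = q - θ z + wordWeight θ l by
        simp [wordWeight]; ring]
      rw [List.map_cons, List.prod_cons, Equiv.Perm.mul_apply, this]
      simp only [pathEdges, cond_false, List.map_cons, List.prod_cons]
      rw [Equiv.Perm.inv_eq_iff_eq]
      simp [labelPerm, mul_assoc]
    · have := ih (q + θ z)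
      rw [show q + wordWeight θ ((z, true) :: l) = q + θ z + wordWeight θ l by
        simp [wordWeight]; ring]
      rw [List.map_cons, List.prod_cons, Equiv.Perm.mul_apply, this]
      simp [pathEdges, labelPerm, mul_assoc]

/-- A forward recursion on sequences indexed by `ℤ` can be solved starting from arbitrary
initial values. -/
theorem exists_recursive_extension {Q : Type*} (Rel : (ℤ → Q) → ℤ → Prop) (c : ℤ)
    (hdep : ∀ s s' j, (∀ i ≤ j + c, s i = s' i) → Rel s j → Rel s' j)
    (hex : ∀ (s : ℤ → Q) (j : ℤ), ∃ s' : ℤ → Q, (∀ i < j + c, s' i = s i) ∧ Rel s' j)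
    (s₀ : ℤ → Q) (J : ℤ) :
    ∃ s : ℤ → Q, (∀ i < J + c, s i = s₀ i) ∧ ∀ j, J ≤ j → Rel s j := by
  choose next hnext hrel using hex
  let S : ℕ → ℤ → Q := fun n => Nat.rec s₀ (fun k s => next s (J + k)) n
  have hS : ∀ k : ℕ, S (k + 1) = next (S k) (J + k) := fun k => rfl
  have hstep : ∀ k d : ℕ, ∀ i < J + k + c, S (k + d) i = S k i := by
    intro k d
    induction d with
    | zero => intro i _; rfl
    | succ d ih =>
      intro i hi
      rw [← add_assoc, hS, hnext _ _ _ (by push_cast; omega), ih i hi]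
  refine ⟨fun i => S (i - (J + c) + 1).toNat i, fun i hi => ?_, fun j hj => ?_⟩
  · have : (i - (J + c) + 1).toNat = 0 := by omega
    simp only [this]; rfl
  · obtain ⟨k, hk⟩ := Int.eq_ofNat_of_zero_le (sub_nonneg.2 hj)
    have hj' : j = J + k := by omega
    have h1 := hrel (S k) (J + k)
    rw [← hS, ← hj'] at h1
    refine hdep _ _ j (fun i hi => ?_) h1
    obtain ⟨d, hd⟩ := Nat.exists_eq_add_of_le (show (i - (J + c) + 1).toNat ≤ k + 1 by omega)
    rw [hd]
    exact hstep _ _ _ (by omega)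

/-- A labelling by a finite group that satisfies a long enough window of the translates of a
relator, whose top and bottom letters occur once, can be changed outside a given window so as to
become periodic and to satisfy all the translates of the relator. -/
theorem exists_periodic_labelling {Z Q : Type*} [Group Q] [Finite Q]
    {E : List ((Z × ℤ) × Bool)} {a b : Z} {c m : ℤ}
    (hc : OccursOnce (a, c) E) (hac : ∀ p ∈ E, p.1.1 = a → p.1.2 ≤ c)
    (hm : OccursOnce (b, m) E) (hbm : ∀ p ∈ E, p.1.1 = b → m ≤ p.1.2)
    {B C : ℤ} (hB : ∀ p ∈ E, |p.1.2| ≤ B) (hC : 0 ≤ C) (ξ : Z × ℤ → Q)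
    (hξ : ∀ j, -(C + B + 1) ≤ j → j < C + B + 1 →
      FreeGroup.lift ξ (FreeGroup.mk (shiftWord j E)) = 1) :
    ∃ P : ℕ, 0 < P ∧ ∃ η : Z → ZMod P → Q,
      (∀ j, FreeGroup.lift (fun x : Z × ℤ => η x.1 (x.2 : ZMod P))
        (FreeGroup.mk (shiftWord j E)) = 1) ∧
      ∀ z (i : ℤ), |i| ≤ C → η z (i : ZMod P) = ξ (z, i) := by
  classical
  simp only [abs_le] at hB ⊢
  have hcB : -B ≤ c ∧ c ≤ B := by
    obtain ⟨p, hp, hp'⟩ := hc.exists_mem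
    simpa [hp'] using hB p hp
  have hmB : -B ≤ m ∧ m ≤ B := by
    obtain ⟨p, hp, hp'⟩ := hm.exists_mem
    simpa [hp'] using hB p hp
  obtain ⟨J, hJ⟩ : ∃ J, J = C + B + 1 := ⟨_, rfl⟩
  obtain ⟨D, hD⟩ : ∃ D, D = if a = b then 0 else 2 * J + 2 * B + 1 := ⟨_, rfl⟩
  obtain ⟨K, hK⟩ : ∃ K, K = J + B + 1 := ⟨_, rfl⟩
  obtain ⟨L, hL⟩ : ∃ L : ℕ, (L : ℤ) = 2 * K := ⟨(2 * K).toNat, by omega⟩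
  rw [← hJ] at hξ
  have hDeq : a = b → D = 0 := fun h => by rw [hD, if_pos h]
  have hDne : a ≠ b → D = 2 * J + 2 * B + 1 := fun h => by rw [hD, if_neg h]
  have hDm : m ≤ D + c := by
    by_cases h : a = b
    · obtain ⟨p, hp, hp'⟩ := hc.exists_mem
      have := hbm p hp (by rw [hp', h])
      rw [hp'] at this
      have := hDeq h
      omega
    · have := hDne h
      omega
  clear hD
  let wrap : ℤ → ℤ := fun i => (i + K) % L - K
  have hwrap : ∀ p i, (L : ℤ) ∣ p → wrap (i + p) = wrap i := by
    rintro p i ⟨t, rfl⟩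
    simp only [wrap]
    rw [show i + L * t + K = i + K + L * t by ring, Int.add_mul_emod_self_left]
  have hwrap' : ∀ i, -K ≤ i → i < K → wrap i = i := by
    intro i h1 h2
    simp only [wrap]
    rw [Int.emod_eq_of_lt (by omega) (by omega)]
    omega
  let lab : (ℤ → Q) → Z × ℤ → Q := fun s x =>
    if x.1 = a then s x.2 else if x.1 = b then s (x.2 - D) else ξ (x.1, wrap x.2)
  have lab_a : ∀ s i, lab s (a, i) = s i := fun s i => by simp [lab]
  have lab_b : ∀ s i, lab s (b, i) = s (i - D) := fun s i => by
    by_cases h : b = a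
    · have := hDeq h.symm
      simp [lab, h, this]
    · simp [lab, h]
  have lab_ne : ∀ s z i, z ≠ a → z ≠ b → lab s (z, i) = ξ (z, wrap i) := fun s z i h1 h2 => by
    simp [lab, h1, h2]
  let Rel : (ℤ → Q) → ℤ → Prop := fun s j =>
    FreeGroup.lift (lab s) (FreeGroup.mk (shiftWord j E)) = 1
  have range_a : ∀ j i β, ((a, i), β) ∈ shiftWord j E →
      j + m - D ≤ i ∧ i ≤ j + c ∧ (a ≠ b → j + m - D < i) := by
    intro j i β hp
    have hp' := mem_shiftWord.1 hp
    have h1 := hB _ hp'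
    have h2 := hac _ hp' rfl
    simp only at h1 h2
    by_cases h : a = b
    · have h3 := hbm _ hp' h
      have := hDeq h
      simp only at h3
      exact ⟨by omega, by omega, fun h' => absurd h h'⟩
    · have := hDne h
      exact ⟨by omega, by omega, fun _ => by omega⟩
  have range_b : ∀ j i β, ((b, i), β) ∈ shiftWord j E →
      j + m - D ≤ i - D ∧ i - D ≤ j + c ∧ (a ≠ b → i - D < j + c) := by
    intro j i β hp
    have hp' := mem_shiftWord.1 hp
    have h1 := hB _ hp'
    have h2 := hbm _ hp' rfl
    simp only at h1 h2
    by_cases h : a = b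
    · have h3 := hac _ hp' h.symm
      have := hDeq h
      simp only at h3
      exact ⟨by omega, by omega, fun h' => absurd h h'⟩
    · have := hDne h
      exact ⟨by omega, by omega, fun _ => by omega⟩
  have congr_up : ∀ s s' j, (∀ i, j + m - D ≤ i → i < j + c → s i = s' i) →
      ∀ p ∈ shiftWord j E, p.1 ≠ (a, j + c) → lab s p.1 = lab s' p.1 := by
    rintro s s' j h ⟨⟨z, i⟩, β⟩ hp hne
    by_cases ha : z = a
    · subst ha
      have h1 := range_a j i β hp
      have : i ≠ j + c := fun h => hne (by rw [h])
      rw [lab_a, lab_a, h _ (by omega) (by omega)]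
    by_cases hb : z = b
    · subst hb
      have h1 := range_b j i β hp
      rw [lab_b, lab_b, h _ h1.1 (h1.2.2 (Ne.symm ha))]
    · rw [lab_ne _ _ _ ha hb, lab_ne _ _ _ ha hb]
  have congr_down : ∀ s s' j, (∀ i, j + m - D < i → i ≤ j + c → s i = s' i) →
      ∀ p ∈ shiftWord j E, p.1 ≠ (b, j + m) → lab s p.1 = lab s' p.1 := by
    rintro s s' j h ⟨⟨z, i⟩, β⟩ hp hne
    by_cases hb : z = b
    · subst hb
      have h1 := range_b j i β hp
      have : i ≠ j + m := fun h => hne (by rw [h])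
      rw [lab_b, lab_b, h _ (by omega) (by omega)]
    by_cases ha : z = a
    · subst ha
      have h1 := range_a j i β hp
      rw [lab_a, lab_a, h _ (h1.2.2 hb) h1.2.1]
    · rw [lab_ne _ _ _ ha hb, lab_ne _ _ _ ha hb]
  have congr_rel : ∀ s s' j, (∀ i, j + m - D ≤ i → i ≤ j + c → s i = s' i) → Rel s j →
      Rel s' j := by
    intro s s' j h hs
    refine Eq.trans (FreeGroup.lift_mk_congr fun p hp => ?_) hs
    by_cases hp' : p.1 = (a, j + c)
    · rw [hp', lab_a, lab_a, h _ (by omega) le_rfl]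
    · exact (congr_up s s' j (fun i h1 h2 => h i h1 h2.le) p hp hp').symm
  have det_up : ∀ s s' j, (∀ i, j + m - D ≤ i → i < j + c → s i = s' i) → Rel s j → Rel s' j →
      s (j + c) = s' (j + c) := by
    intro s s' j h hs hs'
    have ho := hc.shiftWord j
    rw [add_comm] at ho
    obtain ⟨q, hq⟩ := ho.exists_solution (lab s')
    have h1 := (hq (lab s) (congr_up s s' j h)).1 hs
    have h2 := (hq (lab s') fun _ _ _ => rfl).1 hs'
    rw [← lab_a s, ← lab_a s', h1, h2]
  have det_down : ∀ s s' j, (∀ i, j + m - D < i → i ≤ j + c → s i = s' i) → Rel s j →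
      Rel s' j → s (j + m - D) = s' (j + m - D) := by
    intro s s' j h hs hs'
    have ho := hm.shiftWord j
    rw [add_comm] at ho
    obtain ⟨q, hq⟩ := ho.exists_solution (lab s')
    have h1 := (hq (lab s) (congr_down s s' j h)).1 hs
    have h2 := (hq (lab s') fun _ _ _ => rfl).1 hs'
    rw [← lab_b s, ← lab_b s', h1, h2]
  have hex : ∀ (s : ℤ → Q) (j : ℤ), ∃ s' : ℤ → Q, (∀ i < j + c, s' i = s i) ∧ Rel s' j := by
    intro s j
    have ho := hc.shiftWord j
    rw [add_comm] at ho
    obtain ⟨q, hq⟩ := ho.exists_solution (lab s)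
    have h1 : ∀ i < j + c, Function.update s (j + c) q i = s i := fun i hi =>
      Function.update_of_ne hi.ne _ _
    refine ⟨Function.update s (j + c) q, h1, (hq _ ?_).2 ?_⟩
    · exact congr_up _ _ j fun i _ hi => h1 i hi
    · rw [lab_a, Function.update_self]
  have lab_shift : ∀ (s : ℤ → Q) (p : ℤ), (L : ℤ) ∣ p → ∀ x : Z × ℤ,
      lab s (x.1, x.2 + p) = lab (fun i => s (i + p)) x := by
    rintro s p hp ⟨z, i⟩
    simp only [lab, hwrap p i hp]
    rw [show i + p - D = i - D + p by ring]
  have rel_shift : ∀ s p j, (L : ℤ) ∣ p → Rel s (j + p) → Rel (fun i => s (i + p)) j := by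
    intro s p j hp h
    simp only [Rel] at h ⊢
    rw [← shiftWord_shiftWord, lift_mk_shiftWord] at h
    rw [← h]
    exact FreeGroup.lift_mk_congr fun x _ => (lab_shift s p hp x.1).symm
  let s₀ : ℤ → Q := fun i => if -J - B ≤ i then ξ (a, i) else ξ (b, i + D)
  obtain ⟨s, hs₀, hsrel⟩ := exists_recursive_extension Rel c
    (fun s s' j h => congr_rel s s' j fun i _ => h i) hex s₀ J
  have lab_s : ∀ z i, -J - B ≤ i → i ≤ J + B → (z = a → i < J + c) → (z = b → -J + m ≤ i) →
      lab s (z, i) = ξ (z, i) := by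
    intro z i h1 h2 h3 h4
    by_cases ha : z = a
    · subst ha
      rw [lab_a, hs₀ _ (h3 rfl)]
      exact if_pos h1
    by_cases hb : z = b
    · subst hb
      have h5 := hDne (Ne.symm ha)
      rw [lab_b, hs₀ _ (by omega)]
      simp only [s₀]
      rw [if_neg (by omega)]
      congr 2
      ring
    · rw [lab_ne _ _ _ ha hb, hwrap' _ (by omega) (by omega)]
  have hrel : ∀ j, -J ≤ j → Rel s j := by
    intro j hj
    rcases lt_or_ge j J with h | h
    · refine Eq.trans (FreeGroup.lift_mk_congr fun p hp => ?_) (hξ j hj h)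
      obtain ⟨⟨z, i⟩, β⟩ := p
      have hp' := mem_shiftWord.1 hp
      have h1 := hB _ hp'
      have h2 := hac _ hp'
      have h3 := hbm _ hp'
      simp only at h1 h2 h3
      exact lab_s z i (by omega) (by omega) (fun h => by have := h2 h; omega)
        (fun h => by have := h3 h; omega)
    · exact hsrel j h
  obtain ⟨lo, hlo⟩ : ∃ lo, lo = -J + m - D := ⟨_, rfl⟩
  obtain ⟨ℓ, hℓ⟩ : ∃ ℓ : ℕ, (ℓ : ℤ) = D + c - m := ⟨(D + c - m).toNat, by omega⟩
  obtain ⟨P, hP0, hLP, hP⟩ := exists_period_of_reversible (fun n : ℕ => s (lo + n)) ℓ L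
    (by omega) (by
      intro p j hp h
      have hp' : (L : ℤ) ∣ p := Int.natCast_dvd_natCast.2 hp
      have := det_up s (fun i => s (i + p)) (-J + j) (fun i h1 h2 => by
        have := h (i - lo - j).toNat (by omega)
        rw [show lo + ((j + (i - lo - j).toNat : ℕ) : ℤ) = i by omega,
          show lo + ((j + (i - lo - j).toNat + p : ℕ) : ℤ) = i + p by omega] at this
        exact this) (hrel _ (by omega)) (rel_shift s p _ hp' (hrel _ (by omega)))
      rw [show lo + ((j + ℓ : ℕ) : ℤ) = -J + j + c by omega,
        show lo + ((j + ℓ + p : ℕ) : ℤ) = -J + j + c + p by omega]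
      exact this) (by
      intro p j hp h
      have hp' : (L : ℤ) ∣ p := Int.natCast_dvd_natCast.2 hp
      have := det_down s (fun i => s (i + p)) (-J + j) (fun i h1 h2 => by
        have := h (i - lo - j - 1).toNat (by omega)
        rw [show lo + ((j + 1 + (i - lo - j - 1).toNat : ℕ) : ℤ) = i by omega,
          show lo + ((j + 1 + (i - lo - j - 1).toNat + p : ℕ) : ℤ) = i + p by omega] at this
        exact this) (hrel _ (by omega)) (rel_shift s p _ hp' (hrel _ (by omega)))
      rw [show lo + (j : ℤ) = -J + j + m - D by omega,
        show lo + ((j + p : ℕ) : ℤ) = -J + j + m - D + p by omega]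
      exact this)
  let S : ℤ → Q := fun i => s (lo + (i - lo) % P)
  have hLP' : (L : ℤ) ∣ P := Int.natCast_dvd_natCast.2 hLP
  have hS : ∀ i, lo ≤ i → S i = s i := by
    intro i hi
    obtain ⟨n, hn⟩ := Int.eq_ofNat_of_zero_le (sub_nonneg.2 hi)
    have hper : Function.Periodic (fun n : ℕ => s (lo + n)) P := hP
    have := hper.map_mod_nat n
    simp only [S]
    rw [show i = lo + n by omega, ← this]
    congr 2
    rw [Int.natCast_mod]
    congr 1
    ring
  have hSper : ∀ t i, S (i + P * t) = S i := by
    intro t i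
    simp only [S]
    rw [show i + P * t - lo = i - lo + P * t by ring, Int.add_mul_emod_self_left]
  have hSper' : ∀ t, (fun i => S (i + P * t)) = S := fun t => funext fun i => hSper t i
  have hdvd : ∀ t, (L : ℤ) ∣ P * t := fun t => hLP'.mul_right t
  have hSrel : ∀ j, Rel S j := by
    intro j
    obtain ⟨t, ht⟩ : ∃ t : ℤ, -J ≤ j + P * t := by
      refine ⟨|j| + |J|, ?_⟩
      have h1 : |j| + |J| ≤ P * (|j| + |J|) := le_mul_of_one_le_left (by positivity) (by omega)
      have := neg_abs_le j
      have := neg_abs_le J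
      have := le_abs_self J
      omega
    have h1 : Rel S (j + P * t) := congr_rel s S _ (fun i h1 h2 => (hS i (by omega)).symm)
      (hrel _ ht)
    have := rel_shift S _ _ (hdvd t) h1
    rwa [hSper'] at this
  have hη : ∀ z (i : ℤ), lab S (z, (((i : ZMod P).val : ℕ) : ℤ)) = lab S (z, i) := by
    intro z i
    have : NeZero P := ⟨hP0.ne'⟩
    rw [ZMod.val_intCast]
    have h1 := lab_shift S _ (hdvd (-(i / P))) (z, i)
    rw [hSper'] at h1
    rw [← h1]
    congr 2
    have := Int.emod_add_mul_ediv i P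
    simp only
    linarith
  refine ⟨P, hP0, fun z p => lab S (z, ((p.val : ℕ) : ℤ)), fun j => ?_, fun z i hi => ?_⟩
  · exact Eq.trans (FreeGroup.lift_mk_congr fun p _ => hη _ _) (hSrel j)
  · simp only
    rw [hη, ← lab_s z i (by omega) (by omega) (fun _ => by omega) (fun _ => by omega)]
    by_cases ha : z = a
    · subst ha
      rw [lab_a, lab_a, hS]
      by_cases h : z = b
      · have := hDeq h; omega
      · have := hDne h; omega
    by_cases hb : z = b
    · subst hb
      rw [lab_b, lab_b, hS _ (by omega)]
    · rw [lab_ne _ _ _ ha hb, lab_ne _ _ _ ha hb]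

theorem lift_ofAdd_mk {Z : Type*} (n : ℕ) (θ : Z → ℤ) (l : List (Z × Bool)) :
    FreeGroup.lift (fun z => Multiplicative.ofAdd ((θ z : ℤ) : ZMod n)) (FreeGroup.mk l) =
      Multiplicative.ofAdd ((wordWeight θ l : ℤ) : ZMod n) := by
  simp only [FreeGroup.lift_mk]
  induction l with
  | nil => simp [wordWeight]
  | cons p l ih =>
    obtain ⟨z, _ | _⟩ := p <;> simp [ih, wordWeight]

theorem exists_bound_snd {Z : Type*} (E : List ((Z × ℤ) × Bool)) :
    ∃ B : ℤ, 0 ≤ B ∧ ∀ p ∈ E, |p.1.2| ≤ B := by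
  induction E with
  | nil => exact ⟨0, le_rfl, by simp⟩
  | cons p E ih =>
    obtain ⟨B, h0, hB⟩ := ih
    refine ⟨max B |p.1.2|, le_max_of_le_left h0, fun p' hp' => ?_⟩
    rcases List.mem_cons.1 hp' with rfl | h
    · exact le_max_right _ _
    · exact le_max_of_le_left (hB _ h)

/-- If the path of a relator of weight zero has a top edge and a bottom edge that occur once,
then the one-relator group is residually finite. -/
theorem exists_finite_hom_of_occursOnce {Z G : Type*} [Group G] {θ : Z → ℤ}
    {r : List (Z × Bool)} {a b : Z} {c m : ℤ}
    (hc : OccursOnce (a, c) (pathEdges θ r 0))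
    (hac : ∀ p ∈ pathEdges θ r 0, p.1.1 = a → p.1.2 ≤ c)
    (hm : OccursOnce (b, m) (pathEdges θ r 0))
    (hbm : ∀ p ∈ pathEdges θ r 0, p.1.1 = b → m ≤ p.1.2)
    (hr : wordWeight θ r = 0) (π : FreeGroup Z →* G) (hπ : π (FreeGroup.mk r) = 1)
    (l : List (Z × Bool)) (hl : π (FreeGroup.mk l) ≠ 1) :
    ∃ (Q : Type) (_ : Group Q) (_ : Finite Q) (f : FreeGroup Z →* Q),
      f (FreeGroup.mk r) = 1 ∧ f (FreeGroup.mk l) ≠ 1 := by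
  by_cases hw : wordWeight θ l = 0
  swap
  · refine ⟨Multiplicative (ZMod ((wordWeight θ l).natAbs + 1)), inferInstance, inferInstance,
      FreeGroup.lift (fun z => Multiplicative.ofAdd ((θ z : ℤ) : ZMod _)), ?_, ?_⟩
    · rw [lift_ofAdd_mk, hr, Int.cast_zero, ofAdd_zero]
    · rw [lift_ofAdd_mk]
      intro h
      have h1 : ((wordWeight θ l : ℤ) : ZMod ((wordWeight θ l).natAbs + 1)) = 0 := h
      rw [ZMod.intCast_zmod_eq_zero_iff_dvd] at h1
      exact hw (Int.eq_zero_of_abs_lt_dvd h1 (by push_cast; omega))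
  obtain ⟨B, hB0, hB⟩ := exists_bound_snd (pathEdges θ r 0)
  obtain ⟨C, hC0, hC⟩ := exists_bound_snd (pathEdges θ l 0)
  let π' : FreeGroup (Z × ℤ) →* G := FreeGroup.lift fun x => π (FreeGroup.of x.1)
  have hπ' : ∀ l q, π' (FreeGroup.mk (pathEdges θ l q)) = π (FreeGroup.mk l) := by
    intro l q
    refine (lift_mk_pathEdges_fst θ (fun z => π (FreeGroup.of z)) l q).trans ?_
    exact DFunLike.congr_fun (FreeGroup.ext_hom _ _ (by simp) :
      FreeGroup.lift (fun z => π (FreeGroup.of z)) = π) _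
  obtain ⟨σ, hσπ, hσ⟩ := exists_elimination hc hac π'
    (fun j => by rw [← pathEdges_eq_shiftWord, hπ', hπ]) (-(C + B + 1))
    (2 * (C + B + 1)).toNat
  have hne : σ (FreeGroup.mk (pathEdges θ l 0)) ≠ 1 := by
    intro h
    apply hl
    rw [← hπ' l 0, ← hσπ, MonoidHom.comp_apply, h, map_one]
  obtain ⟨n, f, hf⟩ := FreeGroup.exists_finite_quotient _ hne
  let ξ : Z × ℤ → Equiv.Perm (Fin n) := fun x => f (σ (FreeGroup.of x))
  have hξ : ∀ x, FreeGroup.lift ξ x = f (σ x) := fun x =>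
    DFunLike.congr_fun (FreeGroup.ext_hom _ _ (by simp [ξ]) : FreeGroup.lift ξ = f.comp σ) x
  obtain ⟨P, hP, η, hη, hηξ⟩ := exists_periodic_labelling hc hac hm hbm hB hC0 ξ
    (fun j h1 h2 => by rw [hξ, hσ j h1 (by omega), map_one])
  have : NeZero P := ⟨hP.ne'⟩
  refine ⟨Equiv.Perm (ZMod P × Equiv.Perm (Fin n)), inferInstance, inferInstance,
    FreeGroup.lift (labelPerm θ η), ?_, ?_⟩
  · refine Equiv.ext fun ⟨p, γ⟩ => ?_
    obtain ⟨q, rfl⟩ := ZMod.intCast_surjective p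
    have := lift_labelPerm_apply θ η r q γ
    rw [hr, add_zero, pathEdges_eq_shiftWord, hη, one_mul] at this
    exact this
  · intro h
    have := lift_labelPerm_apply θ η l 0 1
    rw [h, hw, FreeGroup.lift_mk_congr (ξ' := ξ) fun p hp => hηξ _ _ (hC p hp), hξ] at this
    simp only [Equiv.Perm.one_apply, Prod.mk.injEq, mul_one] at this
    exact hf this.2.symm

theorem pathEdges_append {Z : Type*} (θ : Z → ℤ) (l l' : List (Z × Bool)) (q : ℤ) :
    pathEdges θ (l ++ l') q = pathEdges θ l q ++ pathEdges θ l' (q + wordWeight θ l) := by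
  induction l generalizing q with
  | nil => simp [pathEdges, wordWeight]
  | cons p l ih =>
    obtain ⟨z, _ | _⟩ := p
    · simp [pathEdges, wordWeight, ih, add_assoc, sub_eq_add_neg]
    · simp [pathEdges, wordWeight, ih, add_assoc]

theorem pathEdges_neg {Z : Type*} (θ : Z → ℤ) (l : List (Z × Bool)) (q : ℤ) :
    pathEdges (-θ) l (-q) = (pathEdges θ l q).map fun p => ((p.1.1, -p.1.2), p.2) := by
  induction l generalizing q with
  | nil => rfl
  | cons p l ih =>
    obtain ⟨z, _ | _⟩ := p
    · simp only [pathEdges, List.map_cons, ← ih, Pi.neg_apply]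
      rw [show -(q - θ z) = -q - -θ z by ring]
    · simp only [pathEdges, List.map_cons, ← ih, Pi.neg_apply]
      rw [show -(q + θ z) = -q + -θ z by ring]

theorem fst_mem_of_mem_pathEdges {Z : Type*} {θ : Z → ℤ} {l : List (Z × Bool)} {q : ℤ}
    {p : (Z × ℤ) × Bool} (h : p ∈ pathEdges θ l q) : (p.1.1, p.2) ∈ l := by
  induction l generalizing q with
  | nil => simp [pathEdges] at h
  | cons x l ih =>
    obtain ⟨z, _ | _⟩ := x <;> rcases List.mem_cons.1 h with rfl | h
    · simp
    · exact List.mem_cons_of_mem _ (ih h)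
    · simp
    · exact List.mem_cons_of_mem _ (ih h)

section Relator

variable {X A : Type*}

/-- The word in `A ⊕ X` of an element of the free group on `A`. -/
noncomputable def coeffWord (X : Type*) {A : Type*} (h : FreeGroup A) : List ((A ⊕ X) × Bool) :=
  haveI := Classical.decEq A
  h.toWord.map fun p => (Sum.inl p.1, p.2)

/-- The word in `A ⊕ X` represented by a relator over a free group on `A`. -/
noncomputable def expandWord (R : List (X × Bool × FreeGroup A)) : List ((A ⊕ X) × Bool) :=
  R.flatMap fun t => (Sum.inr t.1, t.2.1) :: coeffWord X t.2.2

theorem expandWord_cons (t : X × Bool × FreeGroup A) (R : List (X × Bool × FreeGroup A)) :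
    expandWord (t :: R) = (Sum.inr t.1, t.2.1) :: (coeffWord X t.2.2 ++ expandWord R) := rfl

theorem expandWord_append (R R' : List (X × Bool × FreeGroup A)) :
    expandWord (R ++ R') = expandWord R ++ expandWord R' := List.flatMap_append

theorem mk_coeffWord (h : FreeGroup A) :
    FreeGroup.mk (coeffWord X h) = FreeGroup.map Sum.inl h := by
  classical
  rw [coeffWord, ← FreeGroup.map.mk, FreeGroup.mk_toWord]

theorem wordWeight_append {Z : Type*} (θ : Z → ℤ) (l l' : List (Z × Bool)) :
    wordWeight θ (l ++ l') = wordWeight θ l + wordWeight θ l' := by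
  simp [wordWeight]

theorem wordWeight_coeffWord (θ : X → ℤ) (h : FreeGroup A) :
    wordWeight (Sum.elim 0 θ) (coeffWord X h) = 0 := by
  simp [wordWeight, coeffWord, Function.comp_def]

theorem wordWeight_expandWord (θ : X → ℤ) (R : List (X × Bool × FreeGroup A)) :
    wordWeight (Sum.elim 0 θ) (expandWord R) = wordWeight θ (skel R) := by
  induction R with
  | nil => rfl
  | cons t R ih =>
    rw [expandWord_cons, ← List.singleton_append, wordWeight_append, wordWeight_append, ih,
      wordWeight_coeffWord]
    simp [wordWeight, skel]

theorem phiW_eq_wordWeight (θ : X → ℤ) (W : List (X × Bool)) (j : ℕ) :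
    phiW θ W j = wordWeight θ (W.take j) := rfl

theorem phiW_neg (θ : X → ℤ) (W : List (X × Bool)) (j : ℕ) : phiW (-θ) W j = -phiW θ W j := by
  rw [phiW_eq_wordWeight, phiW_eq_wordWeight]
  induction W.take j with
  | nil => rfl
  | cons p l ih =>
    rw [← List.singleton_append, wordWeight_append, wordWeight_append, ih]
    obtain ⟨z, _ | _⟩ := p <;> simp [wordWeight] <;> ring

theorem phiW_cons_succ (θ : X → ℤ) (w : X × Bool) (W : List (X × Bool)) (j : ℕ) :
    phiW θ (w :: W) (j + 1) = (if w.2 then θ w.1 else -θ w.1) + phiW θ W j := by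
  simp [phiW]

/-- The edges labelled by generators outside the coefficient group, in terms of the skeleton. -/
theorem exists_of_mem_pathEdges_expandWord {θ : X → ℤ} {R : List (X × Bool × FreeGroup A)}
    {q i : ℤ} {x : X} {ε : Bool}
    (h : ((Sum.inr x, i), ε) ∈ pathEdges (Sum.elim 0 θ) (expandWord R) q) :
    ∃ (j : ℕ) (hj : j < (skel R).length), (skel R)[j].1 = x ∧
      i = q + max (phiW θ (skel R) j) (phiW θ (skel R) (j + 1)) + min (θ x) 0 := by
  induction R generalizing q with
  | nil => simp [expandWord, pathEdges] at h
  | cons t R ih =>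
    obtain ⟨y, β, g⟩ := t
    have hskel : skel ((y, β, g) :: R) = (y, β) :: skel R := rfl
    rw [expandWord_cons, ← List.singleton_append, pathEdges_append, pathEdges_append,
      List.mem_append, List.mem_append] at h
    rcases h with h | h | h
    · refine ⟨0, by simp [hskel], ?_⟩
      cases β <;> simp only [pathEdges, List.mem_singleton, Prod.mk.injEq, Sum.inr.injEq,
        Sum.elim_inr] at h <;> obtain ⟨⟨rfl, rfl⟩, rfl⟩ := h <;>
        simp [hskel, phiW] <;> grind
    · have := fst_mem_of_mem_pathEdges h
      simp [coeffWord] at this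
    · obtain ⟨j, hj, h1, h2⟩ := ih h
      refine ⟨j + 1, by simpa [hskel] using hj, by simpa [hskel] using h1, ?_⟩
      rw [h2, hskel, phiW_cons_succ, phiW_cons_succ, wordWeight_coeffWord, ← add_max]
      simp [wordWeight]
      ring

/-- A unique maximum at which the skeleton is reduced gives a top edge that occurs once. -/
theorem exists_occursOnce_top {θ : X → ℤ} {R : List (X × Bool × FreeGroup A)}
    (hadm : IsAdmissible θ (skel R)) (k : Fin (skel R).length)
    (hk : ∀ j : Fin (skel R).length, j ≠ k →
      phiW θ (skel R) (j.1 + 1) < phiW θ (skel R) (k.1 + 1))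
    (hne : ((skel R).get k).1 ≠ ((skel R).get (succIdx (skel R) k)).1) :
    ∃ (a : A ⊕ X) (c : ℤ), OccursOnce (a, c) (pathEdges (Sum.elim 0 θ) (expandWord R) 0) ∧
      ∀ p ∈ pathEdges (Sum.elim 0 θ) (expandWord R) 0, p.1.1 = a → p.1.2 ≤ c := by
  obtain ⟨k, hkR⟩ := k
  have hlt : ∀ j (hj : j < (skel R).length), j ≠ k → (skel R)[j].1 = (skel R)[k].1 →
      max (phiW θ (skel R) j) (phiW θ (skel R) (j + 1)) < phiW θ (skel R) (k + 1) := by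
    intro j hj hjk hx
    refine max_lt ?_ (hk ⟨j, hj⟩ (by simpa using hjk))
    have hsucc : (k + 1) % (skel R).length ≠ j := by
      rintro rfl
      exact hne hx.symm
    rcases j with _ | j
    · have h0 : phiW θ (skel R) 0 = phiW θ (skel R) ((skel R).length - 1 + 1) := by
        rw [Nat.sub_add_cancel (by omega), hadm]; rfl
      rw [h0]
      refine hk ⟨(skel R).length - 1, by omega⟩ ?_
      simp only [ne_eq, Fin.mk.injEq]
      rintro rfl
      apply hsucc
      rw [Nat.sub_add_cancel (by omega), Nat.mod_self]
    · refine hk ⟨j, by omega⟩ ?_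
      simp only [ne_eq, Fin.mk.injEq]
      rintro rfl
      exact hsucc (Nat.mod_eq_of_lt hj)
  have hself : phiW θ (skel R) k ≤ phiW θ (skel R) (k + 1) := by
    rcases k with _ | k
    · have h0 : phiW θ (skel R) 0 = phiW θ (skel R) ((skel R).length - 1 + 1) := by
        rw [Nat.sub_add_cancel (by omega), hadm]; rfl
      rw [h0]
      by_cases h : (skel R).length - 1 = 0
      · rw [h]
      · exact (hk ⟨(skel R).length - 1, by omega⟩ (by simpa using h)).le
    · exact (hk ⟨k, by omega⟩ (by simp)).le
  have hkR' : k < R.length := by simpa [skel] using hkR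
  set a := (skel R)[k].1 with ha
  have haR : R[k].1 = a := by simp [ha, skel]
  set c := phiW θ (skel R) (k + 1) + min (θ a) 0 with hcdef
  have hsplit : R = R.take k ++ R[k] :: R.drop (k + 1) := by simp
  have hedges : pathEdges (Sum.elim 0 θ) (expandWord R) 0 =
      pathEdges (Sum.elim 0 θ) (expandWord (R.take k)) 0 ++
      ((Sum.inr a, c), R[k].2.1) ::
        (pathEdges (Sum.elim 0 θ) (coeffWord X R[k].2.2) (phiW θ (skel R) (k + 1)) ++
        pathEdges (Sum.elim 0 θ) (expandWord (R.drop (k + 1))) (phiW θ (skel R) (k + 1))) := by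
    have hq : wordWeight (Sum.elim 0 θ) (expandWord (R.take k)) = phiW θ (skel R) k := by
      rw [wordWeight_expandWord, phiW_eq_wordWeight, skel, skel, List.map_take]
    have hq' : phiW θ (skel R) (k + 1) = phiW θ (skel R) k +
        if R[k].2.1 then θ a else -θ a := by
      rw [phiW_eq_wordWeight, List.take_succ_eq_append_getElem hkR, wordWeight_append,
        ← phiW_eq_wordWeight]
      simp [wordWeight, skel, ha]
    conv_lhs => rw [hsplit]
    rw [expandWord_append, expandWord_cons, pathEdges_append, ← List.singleton_append,
      pathEdges_append, pathEdges_append, hq, haR, wordWeight_coeffWord]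
    have h1 : 0 + phiW θ (skel R) k + wordWeight (Sum.elim 0 θ)
        [((Sum.inr a : A ⊕ X), R[k].2.1)] = phiW θ (skel R) (k + 1) := by
      rw [hq']; simp [wordWeight]
    rw [h1, add_zero]
    congr 1
    rw [← List.singleton_append (x := ((Sum.inr a, c), _))]
    congr 1
    cases hb : R[k].2.1 <;> simp only [hb] at hq' <;> simp [pathEdges, hcdef] <;> grind
  have hbefore : ∀ i ε, ((Sum.inr a, i), ε) ∈
      pathEdges (Sum.elim 0 θ) (expandWord (R.take k)) 0 → i < c := by
    intro i ε h
    obtain ⟨j, hj, h1, h2⟩ := exists_of_mem_pathEdges_expandWord h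
    have hs : skel (R.take k) = (skel R).take k := by simp [skel]
    simp only [hs] at h1 h2 hj
    have hjk : j < k := by simp at hj; omega
    have := hlt j (by omega) (by omega) (by simpa using h1)
    simp only [phiW_eq_wordWeight, List.take_take] at h2 this
    rw [min_eq_left hjk.le, min_eq_left (by omega : j + 1 ≤ k)] at h2
    rw [h2, hcdef, phiW_eq_wordWeight]
    omega
  have hafter : ∀ i ε, ((Sum.inr a, i), ε) ∈
      pathEdges (Sum.elim 0 θ) (expandWord (R.drop (k + 1))) (phiW θ (skel R) (k + 1)) →
      i < c := by
    intro i ε h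
    obtain ⟨j, hj, h1, h2⟩ := exists_of_mem_pathEdges_expandWord h
    have hs : skel (R.drop (k + 1)) = (skel R).drop (k + 1) := by simp [skel]
    simp only [hs] at h1 h2 hj
    have hj' : k + 1 + j < (skel R).length := by simp at hj; omega
    have := hlt (k + 1 + j) hj' (by omega) (by simpa using h1)
    have hadd : ∀ j, phiW θ (skel R) (k + 1) + phiW θ ((skel R).drop (k + 1)) j =
        phiW θ (skel R) (k + 1 + j) := by
      intro j
      rw [phiW_eq_wordWeight, phiW_eq_wordWeight, phiW_eq_wordWeight, ← wordWeight_append,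
        ← List.take_add]
    rw [add_max, hadd, hadd] at h2
    rw [h2, hcdef]
    simp only [add_assoc] at this ⊢
    omega
  have hcoeff : ∀ i ε q, ((Sum.inr a, i), ε) ∉
      pathEdges (Sum.elim 0 θ) (coeffWord X R[k].2.2) q := by
    intro i ε q h
    have := fst_mem_of_mem_pathEdges h
    simp [coeffWord] at this
  refine ⟨Sum.inr a, c, ⟨_, _, _, hedges, ?_, ?_⟩, ?_⟩
  · rintro ⟨⟨z, i⟩, ε⟩ hp h
    obtain ⟨rfl, rfl⟩ := Prod.mk.inj h
    exact (hbefore _ _ hp).ne rfl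
  · rintro ⟨⟨z, i⟩, ε⟩ hp h
    obtain ⟨rfl, rfl⟩ := Prod.mk.inj h
    rcases List.mem_append.1 hp with hp | hp
    · exact hcoeff _ _ _ hp
    · exact (hafter _ _ hp).ne rfl
  · rintro ⟨⟨z, i⟩, ε⟩ hp rfl
    rw [hedges, List.mem_append, List.mem_cons, List.mem_append] at hp
    rcases hp with hp | hp | hp | hp
    · exact (hbefore _ _ hp).le
    · simp only [Prod.mk.injEq] at hp
      exact hp.1.2.le
    · exact absurd hp (hcoeff _ _ _)
    · exact (hafter _ _ hp).le

/-- A unique minimum at which the skeleton is reduced gives a bottom edge that occurs once. -/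
theorem exists_occursOnce_bottom {θ : X → ℤ} {R : List (X × Bool × FreeGroup A)}
    (hadm : IsAdmissible θ (skel R)) (k : Fin (skel R).length)
    (hk : ∀ j : Fin (skel R).length, j ≠ k →
      phiW θ (skel R) (k.1 + 1) < phiW θ (skel R) (j.1 + 1))
    (hne : ((skel R).get k).1 ≠ ((skel R).get (succIdx (skel R) k)).1) :
    ∃ (b : A ⊕ X) (m : ℤ), OccursOnce (b, m) (pathEdges (Sum.elim 0 θ) (expandWord R) 0) ∧
      ∀ p ∈ pathEdges (Sum.elim 0 θ) (expandWord R) 0, p.1.1 = b → m ≤ p.1.2 := by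
  have hadm' : IsAdmissible (-θ) (skel R) := by
    rw [IsAdmissible, phiW_neg, hadm, neg_zero]
  obtain ⟨b, c, h1, h2⟩ := exists_occursOnce_top hadm' k
    (fun j hj => by rw [phiW_neg, phiW_neg]; exact neg_lt_neg (hk j hj)) hne
  have hneg : Sum.elim (0 : A → ℤ) (-θ) = -Sum.elim (0 : A → ℤ) θ := by
    ext (z | z) <;> simp
  have he := pathEdges_neg (-Sum.elim (0 : A → ℤ) θ) (expandWord R) 0
  have he' := pathEdges_neg (Sum.elim (0 : A → ℤ) θ) (expandWord R) 0
  rw [neg_zero] at he'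
  rw [neg_neg, neg_zero] at he
  rw [hneg] at h1 h2
  refine ⟨b, -c, ?_, fun p hp hpb => ?_⟩
  · rw [he]
    exact h1.map (f := fun x : (A ⊕ X) × ℤ => (x.1, -x.2))
      fun x y h => by simpa [Prod.ext_iff] using h
  · have := h2 ((p.1.1, -p.1.2), p.2) (by rw [he']; exact List.mem_map_of_mem hp) hpb
    simp only at this
    omega

theorem lift_map_relWord (R : List (X × Bool × FreeGroup A)) :
    Coprod.lift (FreeGroup.map Sum.inl) (FreeGroup.map Sum.inr) (relWord R) =
      (FreeGroup.mk (expandWord R) : FreeGroup (A ⊕ X)) := by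
  induction R with
  | nil => simp [relWord, expandWord, FreeGroup.one_eq_mk]
  | cons t R ih =>
    rw [relWord] at ih ⊢
    rw [List.map_cons, List.prod_cons, map_mul, ih, map_mul, Coprod.lift_apply_inr,
      Coprod.lift_apply_inl, FreeGroup.map.mk, ← mk_coeffWord, FreeGroup.mul_mk,
      FreeGroup.mul_mk]
    rfl

end Relator

/-- **Theorem 4**, first part (Pride). Every `M_Φ`-group, where `Φ` is a free
group, is a residually finite (one-relator) group. -/
theorem relGroup_residuallyFinite_of_free {X A : Type*}
    (R : List (X × Bool × FreeGroup A)) (hP : HasUniqueMaxMin (skel R)) :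
    ResiduallyFinite (relGroup R) := by
  classical
  obtain ⟨θ, -, -, -, hadm, k, l, hk, hl, hkne, hlne⟩ := hP
  obtain ⟨a, c, hc, hac⟩ := exists_occursOnce_top hadm k hk hkne
  obtain ⟨b, m, hm, hbm⟩ := exists_occursOnce_bottom hadm l hl hlne
  have hr : wordWeight (Sum.elim 0 θ) (expandWord R) = 0 := by
    rw [wordWeight_expandWord, ← hadm, phiW_eq_wordWeight, List.take_length]
  let Φ : Coprod (FreeGroup A) (FreeGroup X) →* FreeGroup (A ⊕ X) :=
    Coprod.lift (FreeGroup.map Sum.inl) (FreeGroup.map Sum.inr)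
  let Ψ : FreeGroup (A ⊕ X) →* Coprod (FreeGroup A) (FreeGroup X) :=
    FreeGroup.lift (Sum.elim (Coprod.inl ∘ FreeGroup.of) (Coprod.inr ∘ FreeGroup.of))
  have hΨΦ : Ψ.comp Φ = MonoidHom.id _ := by
    ext <;> simp [Φ, Ψ]
  have hΨΦ' : ∀ w, Ψ (Φ w) = w := DFunLike.congr_fun hΨΦ
  have hΦR : Φ (relWord R) = FreeGroup.mk (expandWord R) := lift_map_relWord R
  let π : FreeGroup (A ⊕ X) →* relGroup R :=
    (QuotientGroup.mk' (Subgroup.normalClosure {relWord R})).comp Ψ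
  have hπ : π (FreeGroup.mk (expandWord R)) = 1 := by
    rw [← hΦR]
    change (QuotientGroup.mk' (Subgroup.normalClosure {relWord R})) (Ψ (Φ (relWord R))) = 1
    rw [hΨΦ']
    exact (QuotientGroup.eq_one_iff _).2 (Subgroup.subset_normalClosure rfl)
  intro g hg
  obtain ⟨w, rfl⟩ := QuotientGroup.mk'_surjective (Subgroup.normalClosure {relWord R}) g
  obtain ⟨Q, hQ, hQf, f, hf, hf'⟩ := exists_finite_hom_of_occursOnce hc hac hm hbm hr π hπ
    (Φ w).toWord (by
      rw [FreeGroup.mk_toWord]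
      change (QuotientGroup.mk' (Subgroup.normalClosure {relWord R})) (Ψ (Φ w)) ≠ 1
      rwa [hΨΦ'])
  rw [FreeGroup.mk_toWord] at hf'
  refine ⟨Q, hQ, hQf, QuotientGroup.lift _ (f.comp Φ) ?_, hf'⟩
  refine Subgroup.normalClosure_le_normal ?_
  rintro _ rfl
  change f (Φ (relWord R)) = 1
  rw [hΦR, hf]
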